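/- Let Y be a real Banach space. If Y satisfies condition (3) with a function ν, then Y has the approximate hyperplane sum property for ℓ∞⁴ with the function γ(ε) = ν(ε/4). -/

import Mathlib

/-- `M_Y^4`: quadruples `(y₁,y₂,y₃,y₄)` in the closed unit ball of `Y` such that
`‖y_{i₁} − y_{i₂} + y_{i₃}‖ ≤ 1` for all `i₁ < i₂ < i₃`. -/
def MY4 {Y : Type*} [NormedAddCommGroup Y] (y : Fin 4 → Y) : Prop :=
  (∀ i, ‖y i‖ ≤ 1) ∧
    ∀ i j k : Fin 4, i < j → j < k → ‖y i - y j + y k‖ ≤ 1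

/-- `Y` has the approximate hyperplane sum property for `ℓ∞⁴` with the function `γ`. -/
def AHSpL4With (Y : Type*) [NormedAddCommGroup Y] [NormedSpace ℝ Y] (γ : ℝ → ℝ) : Prop :=
  ∀ ε : ℝ, 0 < ε → ε < 1 →
    (0 < γ ε ∧ γ ε < ε) ∧
    ∀ y : Fin 4 → Y, MY4 y →
      ∀ A : Finset (Fin 4), A.Nonempty →
        ∀ f : Y →L[ℝ] ℝ, ‖f‖ = 1 →
          (∀ i ∈ A, 1 - γ ε < f (y i)) →
          ∃ z : Fin 4 → Y, MY4 z ∧ (∀ i, ‖z i - y i‖ < ε) ∧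
            ‖∑ i ∈ A, z i‖ = (A.card : ℝ)

/-- Condition (3) of Proposition 2.9 for `Y` with the function `ν`. -/
def Cond3With (Y : Type*) [NormedAddCommGroup Y] [NormedSpace ℝ Y] (ν : ℝ → ℝ) : Prop :=
  ∀ ε : ℝ, 0 < ε → ε < 1 →
    (0 < ν ε ∧ ν ε < ε) ∧
    ∀ y : Fin 4 → Y, MY4 y →
      ∀ α : Fin 4 → ℝ, (∀ i, 0 ≤ α i) → (∑ i, α i) = 1 →
        1 - ν ε < ‖∑ i, α i • y i‖ →
        ∃ A : Finset (Fin 4), ∃ z : Fin 4 → Y, MY4 z ∧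
          1 - ε < (∑ i ∈ A, α i) ∧ (∀ i, ‖z i - y i‖ < ε) ∧
          ‖∑ i ∈ A, z i‖ = (A.card : ℝ)

/-- In the unit ball, if a finite sum has the largest possible norm, so do all its subsums. -/
theorem norm_sum_eq_card_of_subset {Y ι : Type*} [NormedAddCommGroup Y] [DecidableEq ι]
    {A B : Finset ι} (hAB : A ⊆ B) {z : ι → Y} (hz : ∀ i, ‖z i‖ ≤ 1)
    (hB : ‖∑ i ∈ B, z i‖ = (B.card : ℝ)) : ‖∑ i ∈ A, z i‖ = (A.card : ℝ) := by
  have hle : ∀ s : Finset ι, ‖∑ i ∈ s, z i‖ ≤ (s.card : ℝ) := fun s => by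
    simpa using norm_sum_le_of_le s (fun i _ => hz i)
  refine le_antisymm (hle A) ?_
  have hsum := Finset.sum_sdiff (f := z) hAB
  have htri := norm_add_le (∑ i ∈ B \ A, z i) (∑ i ∈ A, z i)
  have hcard : ((B \ A).card : ℝ) + A.card = B.card := by
    exact_mod_cast Finset.card_sdiff_add_card_eq_card hAB
  rw [hsum, hB] at htri
  linarith [hle (B \ A)]

/-- If `Y` satisfies condition (3) with the function `ν`, then `Y` has the
AHSp-`ℓ∞⁴` with the function `γ(ε) = ν(ε/4)`. -/
theorem stmt3 (Y : Type*) [NormedAddCommGroup Y] [NormedSpace ℝ Y] [CompleteSpace Y]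
    (ν : ℝ → ℝ) (h : Cond3With Y ν) :
    AHSpL4With Y (fun ε => ν (ε / 4)) := by
  intro ε hε hε1
  obtain ⟨⟨hν0, hνlt⟩, hν⟩ := h (ε / 4) (by linarith) (by linarith)
  refine ⟨⟨hν0, by linarith⟩, fun y hy A hA f hf hfy => ?_⟩
  have hcard : (0 : ℝ) < A.card := by exact_mod_cast hA.card_pos
  have hcard4 : (A.card : ℝ) ≤ 4 := by exact_mod_cast A.card_le_univ
  have hinv : (1 / 4 : ℝ) ≤ (A.card : ℝ)⁻¹ := by
    rw [one_div]
    exact inv_anti₀ hcard hcard4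
  let α : Fin 4 → ℝ := fun i => if i ∈ A then (A.card : ℝ)⁻¹ else 0
  have hα0 : ∀ i, 0 ≤ α i := fun i => by
    dsimp only [α]
    split_ifs <;> positivity
  have hα1 : ∑ i, α i = 1 := by
    simp [α, hcard.ne']
  have hnorm : 1 - ν (ε / 4) < ‖∑ i, α i • y i‖ := by
    have hfsum : f (∑ i, α i • y i) = (A.card : ℝ)⁻¹ * ∑ i ∈ A, f (y i) := by
      simp [α, Finset.mul_sum]
    have hlt : (A.card : ℝ) * (1 - ν (ε / 4)) < ∑ i ∈ A, f (y i) := by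
      simpa [mul_sub] using Finset.sum_lt_sum_of_nonempty hA hfy
    calc 1 - ν (ε / 4) < (A.card : ℝ)⁻¹ * ∑ i ∈ A, f (y i) := by
          rwa [lt_inv_mul_iff₀ hcard]
      _ = f (∑ i, α i • y i) := hfsum.symm
      _ ≤ ‖f (∑ i, α i • y i)‖ := Real.le_norm_self _
      _ ≤ ‖∑ i, α i • y i‖ := by simpa [hf] using f.le_opNorm (∑ i, α i • y i)
  obtain ⟨B, z, hz, hB, hzy, hBz⟩ := hν y hy α hα0 hα1 hnorm
  have hAB : A ⊆ B := fun i hi => by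
    by_contra hiB
    have hle : ∑ j ∈ insert i B, α j ≤ ∑ j, α j :=
      Finset.sum_le_sum_of_subset_of_nonneg (Finset.subset_univ _) fun j _ _ => hα0 j
    have hαi : α i = (A.card : ℝ)⁻¹ := if_pos hi
    rw [Finset.sum_insert hiB, hα1, hαi] at hle
    linarith
  exact ⟨z, hz, fun i => (hzy i).trans (by linarith), norm_sum_eq_card_of_subset hAB hz.1 hBz⟩
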